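/- The three ℝ-algebras Γ₁ = ℝ[x,y]/(xy − 1), Γ₂ = ℝ[x,y]/(x² + y² − 1), Γ₃ = ℝ[x,y]/(x² + y² + 1) are pairwise non-isomorphic, the complexification Γᵢ ⊗_ℝ ℂ of each is isomorphic as a ℂ-algebra to the Laurent polynomial ring ℂ[T, T⁻¹], and every commutative ℝ-algebra whose complexification is isomorphic to ℂ[T, T⁻¹] as a ℂ-algebra is isomorphic to one of Γ₁, Γ₂, Γ₃. (Thus the affine complex curve 𝔸¹_ℂ ∖ {0} has exactly three isomorphism classes of real forms.) -/

import Mathlib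

open MvPolynomial
open scoped TensorProduct

/-- The defining polynomials of the three real conics `xy = 1`, `x² + y² = 1`,
`x² + y² = -1`. -/
noncomputable def conic12 : Fin 3 → MvPolynomial (Fin 2) ℝ :=
  ![X 0 * X 1 - 1,
    X 0 ^ 2 + X 1 ^ 2 - 1,
    X 0 ^ 2 + X 1 ^ 2 + 1]
set_option linter.unusedSimpArgs false

section RealForms

abbrev LL := LaurentPolynomial ℂ
abbrev Gam (i : Fin 3) := MvPolynomial (Fin 2) ℝ ⧸ Ideal.span {conic12 i}

theorem LL_unit (f : LL) (hf : IsUnit f) :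
    ∃ (c : ℂ) (n : ℤ), c ≠ 0 ∧ f = LaurentPolynomial.C c * LaurentPolynomial.T n := by
  obtain ⟨g, hg⟩ := hf.exists_right_inv
  obtain ⟨m, F, hF⟩ := LaurentPolynomial.exists_T_pow f
  obtain ⟨k, G, hG⟩ := LaurentPolynomial.exists_T_pow g
  have h : F * G = Polynomial.X ^ (m + k) := by
    apply Polynomial.toLaurent_injective
    rw [map_mul, hF, hG, Polynomial.toLaurent_X_pow]
    push_cast
    rw [LaurentPolynomial.T_add]
    linear_combination (LaurentPolynomial.T (m:ℤ) * LaurentPolynomial.T (k:ℤ)) * hg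
  obtain ⟨j, -, hj⟩ := (dvd_prime_pow Polynomial.prime_X _).1 (Dvd.intro _ h)
  obtain ⟨u, hu⟩ := hj.symm
  obtain ⟨c, hc, hcu⟩ := Polynomial.isUnit_iff.1 u.isUnit
  refine ⟨c, j - m, hc.ne_zero, ?_⟩
  have h1 : f * LaurentPolynomial.T m = LaurentPolynomial.C c * LaurentPolynomial.T j := by
    rw [← hF, ← hu, ← hcu, map_mul, Polynomial.toLaurent_X_pow, Polynomial.toLaurent_C, mul_comm]
  have h2 : (LaurentPolynomial.T (m:ℤ) * LaurentPolynomial.T (-m:ℤ) : LL) = 1 := by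
    rw [← LaurentPolynomial.T_add]; simp
  rw [LaurentPolynomial.T_sub]
  linear_combination LaurentPolynomial.T (-m:ℤ) * h1 - f * h2

theorem TT : (LaurentPolynomial.T 1 * LaurentPolynomial.T (-1) : LL) = 1 := by
  rw [← LaurentPolynomial.T_add]; simp

theorem LL_hom_ext {B : Type*} [CommRing B] (f g : LL →+* B)
    (hC : ∀ z, f (LaurentPolynomial.C z) = g (LaurentPolynomial.C z))
    (hT : f (LaurentPolynomial.T 1) = g (LaurentPolynomial.T 1)) : f = g := by
  have e1 := congrArg f TT
  have e2 := congrArg g TT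
  rw [map_mul, map_one] at e1 e2
  have hT' : f (LaurentPolynomial.T (-1)) = g (LaurentPolynomial.T (-1)) := by
    rw [← hT] at e2
    linear_combination g (LaurentPolynomial.T (-1)) * e1 - f (LaurentPolynomial.T (-1)) * e2
  refine RingHom.ext fun p => ?_
  induction p using LaurentPolynomial.induction_on with
  | h_C a => exact hC a
  | h_add hp hq => rw [map_add, map_add, hp, hq]
  | h_C_mul_T n a h => 
    rw [LaurentPolynomial.T_add, ← mul_assoc, map_mul, map_mul g, h, hT]
  | h_C_mul_T_Z n a h => 
    rw [LaurentPolynomial.T_sub, ← mul_assoc, map_mul, map_mul g, h, hT']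

noncomputable def LL_lift {B : Type*} [CommRing B] [Algebra ℂ B] (u : Bˣ) : LL →ₐ[ℂ] B where
  __ := LaurentPolynomial.eval₂ (algebraMap ℂ B) u
  commutes' r := by
    rw [← LaurentPolynomial.C_eq_algebraMap]
    exact LaurentPolynomial.eval₂_C _ _ _

theorem LL_lift_T {B : Type*} [CommRing B] [Algebra ℂ B] (u : Bˣ) (n : ℤ) :
    LL_lift u (LaurentPolynomial.T n) = ((u ^ n : Bˣ) : B) :=
  LaurentPolynomial.eval₂_T _ _ _

theorem LL_algHom_ext {B : Type*} [CommRing B] [Algebra ℂ B] (f g : LL →ₐ[ℂ] B)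
    (hT : f (LaurentPolynomial.T 1) = g (LaurentPolynomial.T 1)) : f = g := by
  have := LL_hom_ext f.toRingHom g.toRingHom (fun z => by
    rw [LaurentPolynomial.C_eq_algebraMap]
    exact (f.commutes z).trans (g.commutes z).symm) hT
  refine AlgHom.ext fun x => ?_
  exact congrArg (fun h : LL →+* B => h x) this

theorem conic_ev0 {B : Type*} [CommRing B] [Algebra ℝ B] (v : Fin 2 → B) :
    aeval v (conic12 0) = v 0 * v 1 - 1 := by simp [conic12]
theorem conic_ev1 {B : Type*} [CommRing B] [Algebra ℝ B] (v : Fin 2 → B) :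
    aeval v (conic12 1) = v 0 ^ 2 + v 1 ^ 2 - 1 := by simp [conic12]
theorem conic_ev2 {B : Type*} [CommRing B] [Algebra ℝ B] (v : Fin 2 → B) :
    aeval v (conic12 2) = v 0 ^ 2 + v 1 ^ 2 + 1 := by simp [conic12]

noncomputable def gX (i : Fin 3) (k : Fin 2) : Gam i := Ideal.Quotient.mk _ (X k)

noncomputable def gLift (i : Fin 3) {B : Type*} [CommRing B] [Algebra ℝ B] (v : Fin 2 → B)
    (h : aeval v (conic12 i) = 0) : Gam i →ₐ[ℝ] B :=
  Ideal.Quotient.liftₐ _ (aeval v) (by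
    intro a ha
    obtain ⟨b, rfl⟩ := Ideal.mem_span_singleton'.1 ha
    rw [map_mul, h, mul_zero])

theorem gLift_mk (i : Fin 3) {B : Type*} [CommRing B] [Algebra ℝ B] (v : Fin 2 → B)
    (h : aeval v (conic12 i) = 0) (p) : gLift i v h (Ideal.Quotient.mk _ p) = aeval v p := rfl

theorem gLift_X (i : Fin 3) {B : Type*} [CommRing B] [Algebra ℝ B] (v : Fin 2 → B)
    (h : aeval v (conic12 i) = 0) (k) : gLift i v h (gX i k) = v k := by
  rw [gX, gLift_mk, aeval_X]

theorem g_ext (i : Fin 3) {B : Type*} [CommRing B] [Algebra ℝ B] (f g : Gam i →ₐ[ℝ] B)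
    (h : ∀ k, f (gX i k) = g (gX i k)) : f = g := by
  apply Ideal.Quotient.algHom_ext
  apply MvPolynomial.algHom_ext
  exact h

theorem hom_rel (i : Fin 3) {B : Type*} [CommRing B] [Algebra ℝ B] (f : Gam i →ₐ[ℝ] B) :
    aeval (fun k => f (gX i k)) (conic12 i) = 0 := by
  have : (aeval (fun k => f (gX i k)) : MvPolynomial (Fin 2) ℝ →ₐ[ℝ] B) =
      f.comp (Ideal.Quotient.mkₐ ℝ _) := by
    apply MvPolynomial.algHom_ext
    intro k
    rw [aeval_X]; rfl
  rw [this]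
  have h0 : (Ideal.Quotient.mkₐ ℝ (Ideal.span {conic12 i})) (conic12 i) = 0 :=
    Ideal.Quotient.eq_zero_iff_mem.2 (Ideal.mem_span_singleton_self _)
  rw [AlgHom.comp_apply, h0, map_zero]

/-! Non-isomorphism -/

theorem no_pt (f : Gam 2 →ₐ[ℝ] ℝ) : False := by
  have := hom_rel 2 f
  rw [conic_ev2] at this
  nlinarith [sq_nonneg (f (gX 2 0)), sq_nonneg (f (gX 2 1))]

theorem has_pt0 (t : ℝ) (ht : t ≠ 0) : ∃ f : Gam 0 →ₐ[ℝ] ℝ, f (gX 0 0) = t :=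
  ⟨gLift 0 ![t, t⁻¹] (by rw [conic_ev0]; simp [ht]), by rw [gLift_X]; rfl⟩

theorem has_pt1 (t : ℝ) : ∃ f : Gam 1 →ₐ[ℝ] ℝ, ∀ k, f (gX 1 k) = ![Real.cos t, Real.sin t] k :=
  ⟨gLift 1 ![Real.cos t, Real.sin t] (by rw [conic_ev1]; simp), fun k => by rw [gLift_X]⟩

theorem pt1_param (f : Gam 1 →ₐ[ℝ] ℝ) :
    ∃ t, ∀ k, f (gX 1 k) = ![Real.cos t, Real.sin t] k := by
  have := hom_rel 1 f
  rw [conic_ev1] at this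
  set z : ℂ := ⟨f (gX 1 0), f (gX 1 1)⟩ with hz
  have hn : ‖z‖ = 1 := by
    rw [Complex.norm_def, Real.sqrt_eq_one, Complex.normSq_apply]; simp only [hz]; linarith
  refine ⟨z.arg, fun k => ?_⟩
  have h1 := Complex.norm_mul_cos_arg z
  have h2 := Complex.norm_mul_sin_arg z
  rw [hn, one_mul] at h1 h2
  fin_cases k
  · simpa using h1.symm
  · simpa using h2.symm

theorem no_iso01 (e : Gam 0 ≃ₐ[ℝ] Gam 1) : False := by
  obtain ⟨p, hp⟩ := has_pt0 1 one_ne_zero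
  obtain ⟨q, hq⟩ := has_pt0 (-1) (by norm_num)
  obtain ⟨g, hg⟩ := Ideal.Quotient.mk_surjective (e (gX 0 0))
  let F : ℝ → ℝ := fun t => aeval ![Real.cos t, Real.sin t] g
  have key : ∀ (f : Gam 1 →ₐ[ℝ] ℝ) t, (∀ k, f (gX 1 k) = ![Real.cos t, Real.sin t] k) →
      f (e (gX 0 0)) = F t := by
    intro f t h
    rw [← hg]
    have : (aeval ![Real.cos t, Real.sin t] : MvPolynomial (Fin 2) ℝ →ₐ[ℝ] ℝ) =
      f.comp (Ideal.Quotient.mkₐ ℝ _) := by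
      apply MvPolynomial.algHom_ext
      intro k
      rw [aeval_X, ← h]; rfl
    simp only [F]
    rw [this]; rfl
  have hF : Continuous F := by
    have : Continuous fun t : ℝ => (![Real.cos t, Real.sin t] : Fin 2 → ℝ) := by
      refine continuous_pi fun k => ?_
      fin_cases k
      · exact Real.continuous_cos
      · exact Real.continuous_sin
    simp only [F, MvPolynomial.aeval_eq_eval]
    exact (MvPolynomial.continuous_eval g).comp this
  obtain ⟨a, ha⟩ := pt1_param (p.comp e.symm.toAlgHom)
  obtain ⟨b, hb⟩ := pt1_param (q.comp e.symm.toAlgHom)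
  have ha' := key _ a ha
  have hb' := key _ b hb
  have ha2 : F a = 1 := by rw [← ha', ← hp]; simp
  have hb2 : F b = -1 := by rw [← hb', ← hq]; simp
  obtain ⟨t, ht⟩ : ∃ t, F t = 0 := 
    mem_range_of_exists_le_of_exists_ge hF ⟨b, by rw [hb2]; norm_num⟩ ⟨a, by rw [ha2]; norm_num⟩
  obtain ⟨f, hf⟩ := has_pt1 t
  have h3 := key f t hf
  have h4 := hom_rel 0 (f.comp e.toAlgHom)
  rw [conic_ev0] at h4
  have h5 : (f.comp e.toAlgHom) (gX 0 0) = 0 := by rw [← ht, ← h3]; rfl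
  simp only [h5] at h4
  norm_num at h4

theorem no_iso (i j : Fin 3) (hij : i ≠ j) (e : Gam i ≃ₐ[ℝ] Gam j) : False := by
  obtain ⟨p, -⟩ := has_pt0 1 one_ne_zero
  obtain ⟨q, -⟩ := has_pt1 0
  fin_cases i <;> fin_cases j
  · exact hij rfl
  · exact no_iso01 e
  · exact no_pt (p.comp e.symm.toAlgHom)
  · exact no_iso01 e.symm
  · exact hij rfl
  · exact no_pt (q.comp e.symm.toAlgHom)
  · exact no_pt (p.comp e.toAlgHom)
  · exact no_pt (q.comp e.toAlgHom)
  · exact hij rfl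

/-! Complexifications -/

theorem tens_ext (i : Fin 3) {B : Type*} [CommRing B] [Algebra ℝ B] [Algebra ℂ B]
    [IsScalarTower ℝ ℂ B] (f g : (ℂ ⊗[ℝ] Gam i) →ₐ[ℂ] B)
    (h : ∀ k, f (1 ⊗ₜ gX i k) = g (1 ⊗ₜ gX i k)) : f = g := by
  apply Algebra.TensorProduct.ext_ring
  exact g_ext i _ _ h

structure Pres (i : Fin 3) (G : Type) [CommRing G] [Algebra ℝ G] (x : Fin 2 → G) : Prop where
  rel : aeval x (conic12 i) = 0
  lift : ∀ v : Fin 2 → LL, aeval v (conic12 i) = 0 → ∃ f : G →ₐ[ℝ] LL, ∀ k, f (x k) = v k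
  ext : ∀ f g : G →ₐ[ℝ] ℂ ⊗[ℝ] G, (∀ k, f (x k) = g (x k)) → f = g

theorem mk_equiv (i : Fin 3) {G : Type} [CommRing G] [Algebra ℝ G]
    {x : Fin 2 → G} (P : Pres i G x) (v : Fin 2 → LL) (hv : aeval v (conic12 i) = 0)
    (u w : ℂ ⊗[ℝ] G) (huw : u * w = 1)
    (h1 : ∀ f : (ℂ ⊗[ℝ] G) →ₐ[ℂ] LL, (∀ k, f (1 ⊗ₜ x k) = v k) →
      f u = LaurentPolynomial.T 1)
    (h2 : ∀ g : LL →ₐ[ℂ] (ℂ ⊗[ℝ] G), g (LaurentPolynomial.T 1) = u →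
      g (LaurentPolynomial.T (-1)) = w → ∀ k, g (v k) = 1 ⊗ₜ x k) :
    ∃ e : (ℂ ⊗[ℝ] G) ≃ₐ[ℂ] LL, ∀ k, e (1 ⊗ₜ x k) = v k := by
  obtain ⟨f0, hf0⟩ := P.lift v hv
  let f : (ℂ ⊗[ℝ] G) →ₐ[ℂ] LL :=
    Algebra.TensorProduct.lift (Algebra.ofId ℂ LL) f0 (fun _ _ => Commute.all _ _)
  have hf : ∀ k, f (1 ⊗ₜ x k) = v k := by
    intro k
    simp only [f, Algebra.TensorProduct.lift_tmul, map_one, one_mul, hf0]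
  let U : (ℂ ⊗[ℝ] G)ˣ := ⟨u, w, huw, by rw [mul_comm, huw]⟩
  let g : LL →ₐ[ℂ] (ℂ ⊗[ℝ] G) := LL_lift U
  have hg : g (LaurentPolynomial.T 1) = u := by
    simp only [g, LL_lift_T, zpow_one]; rfl
  have hg' : g (LaurentPolynomial.T (-1)) = w := by
    simp only [g, LL_lift_T, zpow_neg_one]; rfl
  refine ⟨AlgEquiv.ofAlgHom f g ?_ ?_, hf⟩
  · apply LL_algHom_ext
    rw [AlgHom.comp_apply, hg, h1 f hf]; rfl
  · apply Algebra.TensorProduct.ext_ring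
    apply P.ext
    intro k
    change g (f (1 ⊗ₜ x k)) = 1 ⊗ₜ x k
    rw [hf, h2 g hg hg']

noncomputable def vv : Fin 3 → Fin 2 → LL :=
  ![![LaurentPolynomial.T 1, LaurentPolynomial.T (-1)],
    ![(1/2 : ℂ) • (LaurentPolynomial.T 1 + LaurentPolynomial.T (-1)),
      (-Complex.I/2 : ℂ) • (LaurentPolynomial.T 1 - LaurentPolynomial.T (-1))],
    ![(1/2 : ℂ) • (LaurentPolynomial.T 1 - LaurentPolynomial.T (-1)),
      (-Complex.I/2 : ℂ) • (LaurentPolynomial.T 1 + LaurentPolynomial.T (-1))]]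

theorem II {B : Type*} [CommRing B] [Algebra ℂ B] :
    algebraMap ℂ B Complex.I * algebraMap ℂ B Complex.I = -1 := by
  rw [← map_mul, Complex.I_mul_I, map_neg, map_one]

theorem hh {B : Type*} [CommRing B] [Algebra ℂ B] :
    2 * algebraMap ℂ B (1/2) = 1 := by
  rw [show (2 : B) = algebraMap ℂ B 2 from (map_ofNat _ 2).symm, ← map_mul]; norm_num

theorem hI {B : Type*} [CommRing B] [Algebra ℂ B] :
    algebraMap ℂ B (-Complex.I/2) = - algebraMap ℂ B Complex.I * algebraMap ℂ B (1/2) := by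
  rw [← map_neg, ← map_mul]; congr 1; ring

theorem ex_equiv' (i : Fin 3) {G : Type} [CommRing G] [Algebra ℝ G]
    {x : Fin 2 → G} (P : Pres i G x) :
    ∃ e : (ℂ ⊗[ℝ] G) ≃ₐ[ℂ] LL, ∀ k, e (1 ⊗ₜ x k) = vv i k := by
  have hrel : aeval (fun k => (1 : ℂ) ⊗ₜ[ℝ] x k) (conic12 i) = 0 := by
    have h := MvPolynomial.comp_aeval_apply x
      (Algebra.TensorProduct.includeRight : G →ₐ[ℝ] ℂ ⊗[ℝ] G) (conic12 i)
    rw [P.rel, map_zero] at h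
    exact h.symm
  have hsm : ∀ (z : ℂ) (w : ℂ ⊗[ℝ] G), z • w = algebraMap ℂ (ℂ ⊗[ℝ] G) z * w :=
    fun z w => Algebra.smul_def z w
  have hTT := TT
  have hII := II (B := LL)
  have hhh := hh (B := LL)
  fin_cases i
  · refine mk_equiv 0 P (vv 0) ?_ (1 ⊗ₜ x 0) (1 ⊗ₜ x 1) ?_ ?_ ?_
    · rw [conic_ev0]; simp only [vv, Matrix.cons_val]; rw [TT, sub_self]
    · have := hrel
      replace this := (conic_ev0 _).symm.trans this
      exact sub_eq_zero.1 this
    · intro f hf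
      rw [hf]; rfl
    · intro g h1 h2 k
      fin_cases k
      · exact h1
      · exact h2
  · have hII' := II (B := ℂ ⊗[ℝ] G)
    have hhh' := hh (B := ℂ ⊗[ℝ] G)
    refine mk_equiv 1 P (vv 1) ?_ (1 ⊗ₜ x 0 + Complex.I • 1 ⊗ₜ x 1)
      (1 ⊗ₜ x 0 - Complex.I • 1 ⊗ₜ x 1) ?_ ?_ ?_
    · rw [conic_ev1]; simp only [vv, Matrix.cons_val, Algebra.smul_def, hI]
      generalize algebraMap ℂ LL Complex.I = J at *
      generalize algebraMap ℂ LL (1/2) = h at *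
      grind
    · have := hrel
      replace this := (conic_ev1 _).symm.trans this
      simp only [hsm]
      generalize algebraMap ℂ (ℂ ⊗[ℝ] G) Complex.I = J at *
      linear_combination this - (1 ⊗ₜ x 1)^2 * hII'
    · intro f hf
      rw [map_add, map_smul, hf, hf]
      simp only [vv, Matrix.cons_val, Algebra.smul_def, hI]
      generalize algebraMap ℂ LL Complex.I = J at *
      generalize algebraMap ℂ LL (1/2) = h at *
      grind
    · intro g h1 h2 k
      fin_cases k
      · simp only [Fin.zero_eta, Fin.mk_one, vv, Matrix.cons_val, map_smul, map_add, map_sub, h1, h2]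
        simp only [hsm]
        linear_combination (1 ⊗ₜ x 0) * hhh'
      · simp only [Fin.zero_eta, Fin.mk_one, vv, Matrix.cons_val, map_smul, map_add, map_sub, h1, h2]
        simp only [hsm, hI]
        generalize algebraMap ℂ (ℂ ⊗[ℝ] G) Complex.I = J at *
        generalize algebraMap ℂ (ℂ ⊗[ℝ] G) (1/2) = h at *
        linear_combination (1 ⊗ₜ x 1) * hhh' - 2 * h * (1 ⊗ₜ x 1) * hII'
  · have hII' := II (B := ℂ ⊗[ℝ] G)
    have hhh' := hh (B := ℂ ⊗[ℝ] G)
    refine mk_equiv 2 P (vv 2) ?_ (1 ⊗ₜ x 0 + Complex.I • 1 ⊗ₜ x 1)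
      (-(1 ⊗ₜ x 0) + Complex.I • 1 ⊗ₜ x 1) ?_ ?_ ?_
    · rw [conic_ev2]; simp only [vv, Matrix.cons_val, Algebra.smul_def, hI]
      generalize algebraMap ℂ LL Complex.I = J at *
      generalize algebraMap ℂ LL (1/2) = h at *
      grind
    · have := hrel
      replace this := (conic_ev2 _).symm.trans this
      simp only [hsm]
      generalize algebraMap ℂ (ℂ ⊗[ℝ] G) Complex.I = J at *
      linear_combination -this + (1 ⊗ₜ x 1)^2 * hII'
    · intro f hf
      rw [map_add, map_smul, hf, hf]
      simp only [vv, Matrix.cons_val, Algebra.smul_def, hI]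
      generalize algebraMap ℂ LL Complex.I = J at *
      generalize algebraMap ℂ LL (1/2) = h at *
      grind
    · intro g h1 h2 k
      fin_cases k
      · simp only [Fin.zero_eta, Fin.mk_one, vv, Matrix.cons_val, map_smul, map_add, map_sub, h1, h2]
        simp only [hsm]
        linear_combination (1 ⊗ₜ x 0) * hhh'
      · simp only [Fin.zero_eta, Fin.mk_one, vv, Matrix.cons_val, map_smul, map_add, map_sub, h1, h2]
        simp only [hsm, hI]
        generalize algebraMap ℂ (ℂ ⊗[ℝ] G) Complex.I = J at *
        generalize algebraMap ℂ (ℂ ⊗[ℝ] G) (1/2) = h at *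
        linear_combination (1 ⊗ₜ x 1) * hhh' - 2 * h * (1 ⊗ₜ x 1) * hII'

theorem gam_pres (i : Fin 3) : Pres i (Gam i) (gX i) where
  rel := hom_rel i (AlgHom.id ℝ (Gam i))
  lift v hv := ⟨gLift i v hv, gLift_X i v hv⟩
  ext f g h := g_ext i f g h

theorem ex_equiv (i : Fin 3) :
    ∃ e : (ℂ ⊗[ℝ] Gam i) ≃ₐ[ℂ] LL, ∀ k, e (1 ⊗ₜ gX i k) = vv i k :=
  ex_equiv' i (gam_pres i)

/-! Descent -/

section descent
variable {A : Type} [CommRing A] [Algebra ℝ A]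

noncomputable def sig (A : Type) [CommRing A] [Algebra ℝ A] : (ℂ ⊗[ℝ] A) →ₐ[ℝ] (ℂ ⊗[ℝ] A) :=
  Algebra.TensorProduct.map (Complex.conjAe : ℂ →ₐ[ℝ] ℂ) (AlgHom.id ℝ A)

theorem sig_tmul (z : ℂ) (a : A) : sig A (z ⊗ₜ a) = (starRingEnd ℂ z) ⊗ₜ a := by
  simp [sig]

theorem tens_form (w : ℂ ⊗[ℝ] A) : ∃ a b : A, w = 1 ⊗ₜ a + Complex.I ⊗ₜ b := by
  induction w using TensorProduct.induction_on with
  | zero => exact ⟨0, 0, by simp⟩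
  | tmul z a =>
    refine ⟨z.re • a, z.im • a, ?_⟩
    rw [← TensorProduct.smul_tmul, ← TensorProduct.smul_tmul, ← TensorProduct.add_tmul]
    congr 1
    apply Complex.ext <;> simp
  | add x y hx hy =>
    obtain ⟨a, b, rfl⟩ := hx
    obtain ⟨c, d, rfl⟩ := hy
    refine ⟨a + c, b + d, ?_⟩
    rw [TensorProduct.tmul_add, TensorProduct.tmul_add]; abel

theorem sig_sig (w : ℂ ⊗[ℝ] A) : sig A (sig A w) = w := by
  obtain ⟨a, b, rfl⟩ := tens_form w
  simp [sig_tmul]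

theorem sig_fixed (w : ℂ ⊗[ℝ] A) (h : sig A w = w) : ∃ a : A, w = 1 ⊗ₜ a := by
  obtain ⟨a, b, rfl⟩ := tens_form w
  refine ⟨a, ?_⟩
  simp only [map_add, sig_tmul, map_one, Complex.conj_I, TensorProduct.neg_tmul] at h
  have h2 : (2 : ℝ) • (Complex.I ⊗ₜ[ℝ] b) = 0 := by
    rw [two_smul]; 
    linear_combination -h
  rw [(smul_eq_zero.1 h2).resolve_left two_ne_zero, add_zero]

theorem desc_key (i : Fin 3) (φ : (ℂ ⊗[ℝ] A) ≃ₐ[ℂ] LL)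
    (h : ∀ k, sig A (φ.symm (vv i k)) = φ.symm (vv i k)) : Nonempty (A ≃ₐ[ℝ] Gam i) := by
  obtain ⟨e, he⟩ := ex_equiv i
  choose a ha using fun k => sig_fixed _ (h k)
  have inj : Function.Injective (Algebra.TensorProduct.includeRight : A →ₐ[ℝ] ℂ ⊗[ℝ] A) :=
    Algebra.TensorProduct.includeRight_injective (algebraMap ℝ ℂ).injective
  let E : (ℂ ⊗[ℝ] Gam i) ≃ₐ[ℂ] (ℂ ⊗[ℝ] A) := e.trans φ.symm
  have hE : ∀ k, E (1 ⊗ₜ gX i k) = 1 ⊗ₜ a k := by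
    intro k
    simp only [E, AlgEquiv.trans_apply, he, ha]
  let G : Gam i →ₐ[ℝ] (ℂ ⊗[ℝ] A) :=
    (E.toAlgHom.restrictScalars ℝ).comp Algebra.TensorProduct.includeRight
  have hrel : aeval a (conic12 i) = 0 := by
    apply inj
    have h1 := hom_rel i G
    have h2 : (fun k => G (gX i k)) =
        fun k => (Algebra.TensorProduct.includeRight : A →ₐ[ℝ] ℂ ⊗[ℝ] A) (a k) := funext hE
    rw [h2] at h1
    rw [map_zero, ← h1]
    exact MvPolynomial.comp_aeval_apply _ _ _
  let f : Gam i →ₐ[ℝ] A := gLift i a hrel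
  have hEf : E.toAlgHom = Algebra.TensorProduct.map (AlgHom.id ℂ ℂ) f := by
    apply tens_ext
    intro k
    rw [Algebra.TensorProduct.map_tmul, gLift_X]
    exact hE k
  have hb : Function.Bijective (f.toLinearMap.lTensor ℂ) := by
    have : (f.toLinearMap.lTensor ℂ : ℂ ⊗[ℝ] Gam i → ℂ ⊗[ℝ] A) = E := by
      funext x
      exact (congrArg (fun t : (ℂ ⊗[ℝ] Gam i) →ₐ[ℂ] (ℂ ⊗[ℝ] A) => t x) hEf).symm
    rw [this]
    exact E.bijective
  have hb' : Function.Bijective f.toLinearMap :=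
    (Module.FaithfullyFlat.lTensor_bijective_iff_bijective ℝ ℂ f.toLinearMap).1 hb
  exact ⟨(AlgEquiv.ofBijective f hb').symm⟩

noncomputable def tau (φ : (ℂ ⊗[ℝ] A) ≃ₐ[ℂ] LL) : LL →+* LL :=
  (φ : (ℂ ⊗[ℝ] A) →+* LL).comp ((sig A : (ℂ ⊗[ℝ] A) →+* (ℂ ⊗[ℝ] A)).comp
    (φ.symm : LL →+* (ℂ ⊗[ℝ] A)))

theorem tau_apply (φ : (ℂ ⊗[ℝ] A) ≃ₐ[ℂ] LL) (x : LL) : tau φ x = φ (sig A (φ.symm x)) := rfl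

theorem tau_tau (φ : (ℂ ⊗[ℝ] A) ≃ₐ[ℂ] LL) (x : LL) : tau φ (tau φ x) = x := by
  simp [tau_apply, sig_sig]

theorem tau_C (φ : (ℂ ⊗[ℝ] A) ≃ₐ[ℂ] LL) (z : ℂ) :
    tau φ (algebraMap ℂ LL z) = algebraMap ℂ LL (starRingEnd ℂ z) := by
  rw [tau_apply, AlgEquiv.commutes, Algebra.TensorProduct.algebraMap_apply, sig_tmul,
    ← AlgEquiv.commutes φ, Algebra.TensorProduct.algebraMap_apply]
  rfl

theorem tau_smul (φ : (ℂ ⊗[ℝ] A) ≃ₐ[ℂ] LL) (z : ℂ) (x : LL) :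
    tau φ (z • x) = (starRingEnd ℂ z) • tau φ x := by
  rw [Algebra.smul_def, map_mul, tau_C, ← Algebra.smul_def]

theorem desc_key' (i : Fin 3) (φ : (ℂ ⊗[ℝ] A) ≃ₐ[ℂ] LL)
    (h : ∀ k, tau φ (vv i k) = vv i k) : Nonempty (A ≃ₐ[ℝ] Gam i) := by
  apply desc_key i φ
  intro k
  have := congrArg φ.symm (h k)
  rwa [tau_apply, AlgEquiv.symm_apply_apply] at this

theorem T_zpow_unit : ∃ U : LLˣ, ∀ n : ℤ, ((U ^ n : LLˣ) : LL) = LaurentPolynomial.T n := by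
  let U : LLˣ := ⟨LaurentPolynomial.T 1, LaurentPolynomial.T (-1), TT, by rw [mul_comm, TT]⟩
  refine ⟨U, fun n => ?_⟩
  have : LL_lift U = AlgHom.id ℂ LL := by
    apply LL_algHom_ext
    rw [LL_lift_T, zpow_one]; rfl
  rw [← LL_lift_T, this]; rfl

noncomputable def scU (d : ℂˣ) : LLˣ :=
  Units.map (algebraMap ℂ LL).toMonoidHom d * T_zpow_unit.choose

theorem scU_zpow (d : ℂˣ) (n : ℤ) : ((scU d ^ n : LLˣ) : LL) =
    ((d ^ n : ℂˣ) : ℂ) • LaurentPolynomial.T n := by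
  rw [scU, mul_zpow, Units.val_mul, T_zpow_unit.choose_spec, ← map_zpow, Algebra.smul_def]
  rfl

theorem sc_T (d : ℂˣ) (n : ℤ) : LL_lift (scU d) (LaurentPolynomial.T n) =
    ((d ^ n : ℂˣ) : ℂ) • LaurentPolynomial.T n := by
  rw [LL_lift_T, scU_zpow]

theorem sc_inv (d : ℂˣ) : (LL_lift (scU d)).comp (LL_lift (scU d⁻¹)) = AlgHom.id ℂ LL := by
  apply LL_algHom_ext
  rw [AlgHom.comp_apply, sc_T, map_smul, sc_T, smul_smul, ← Units.val_mul]
  simp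

noncomputable def sc (d : ℂˣ) : LL ≃ₐ[ℂ] LL :=
  AlgEquiv.ofAlgHom (LL_lift (scU d)) (LL_lift (scU d⁻¹)) (sc_inv d)
    (by simpa using sc_inv d⁻¹)

theorem tau_sc (φ : (ℂ ⊗[ℝ] A) ≃ₐ[ℂ] LL) (d : ℂˣ) (c : ℂ) (n : ℤ)
    (h : tau φ (LaurentPolynomial.T 1) = c • LaurentPolynomial.T n) :
    tau (φ.trans (sc d)) (LaurentPolynomial.T 1) =
      (starRingEnd ℂ (d⁻¹ : ℂ) * c * (d : ℂ) ^ n) • LaurentPolynomial.T n := by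
  have h1 : tau (φ.trans (sc d)) (LaurentPolynomial.T 1) =
    sc d (tau φ ((sc d).symm (LaurentPolynomial.T 1))) := rfl
  have h2 : (sc d).symm (LaurentPolynomial.T 1) = (d⁻¹ : ℂ) • LaurentPolynomial.T 1 := by
    have := sc_T d⁻¹ 1
    rw [zpow_one] at this
    rw [Units.val_inv_eq_inv_val] at this
    exact this
  have h3 : sc d (LaurentPolynomial.T n) = ((d : ℂ) ^ n) • LaurentPolynomial.T n := by
    have := sc_T d n
    rw [Units.val_zpow_eq_zpow_val] at this
    exact this
  rw [h1, h2, tau_smul, h, map_smul, map_smul, h3, smul_smul, smul_smul, mul_assoc]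

theorem tau_Tinv (φ : (ℂ ⊗[ℝ] A) ≃ₐ[ℂ] LL) (w : LL) 
    (h : tau φ (LaurentPolynomial.T 1) * w = 1) : tau φ (LaurentPolynomial.T (-1)) = w := by
  have := congrArg (tau φ) TT
  rw [map_mul, map_one] at this
  linear_combination w * this - tau φ (LaurentPolynomial.T (-1)) * h

theorem caseA (φ : (ℂ ⊗[ℝ] A) ≃ₐ[ℂ] LL)
    (h : tau φ (LaurentPolynomial.T 1) = LaurentPolynomial.T 1) : Nonempty (A ≃ₐ[ℝ] Gam 0) := by
  have h' := tau_Tinv φ (LaurentPolynomial.T (-1)) (by rw [h, TT])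
  apply desc_key' 0 φ
  intro k
  fin_cases k
  · exact h
  · exact h'

theorem caseB (φ : (ℂ ⊗[ℝ] A) ≃ₐ[ℂ] LL)
    (h : tau φ (LaurentPolynomial.T 1) = LaurentPolynomial.T (-1)) :
    Nonempty (A ≃ₐ[ℝ] Gam 1) := by
  have h' := tau_Tinv φ (LaurentPolynomial.T 1) (by rw [h, mul_comm, TT])
  apply desc_key' 1 φ
  intro k
  fin_cases k
  · simp only [Fin.zero_eta, Fin.mk_one, vv, Matrix.cons_val, tau_smul, map_add, map_sub, h, h']
    rw [map_div₀, map_one, map_ofNat, add_comm]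
  · simp only [Fin.zero_eta, Fin.mk_one, vv, Matrix.cons_val, tau_smul, map_add, map_sub, h, h']
    rw [map_div₀, map_neg, Complex.conj_I, map_ofNat, neg_neg, neg_div, neg_smul, ← smul_neg,
      neg_sub]

theorem caseC (φ : (ℂ ⊗[ℝ] A) ≃ₐ[ℂ] LL)
    (h : tau φ (LaurentPolynomial.T 1) = -LaurentPolynomial.T (-1)) :
    Nonempty (A ≃ₐ[ℝ] Gam 2) := by
  have h' := tau_Tinv φ (-LaurentPolynomial.T 1) (by rw [h, neg_mul_neg, mul_comm, TT])
  apply desc_key' 2 φ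
  intro k
  fin_cases k
  · simp only [Fin.zero_eta, Fin.mk_one, vv, Matrix.cons_val, tau_smul, map_add, map_sub, h, h']
    rw [map_div₀, map_one, map_ofNat]; congr 1; ring
  · simp only [Fin.zero_eta, Fin.mk_one, vv, Matrix.cons_val, tau_smul, map_add, map_sub, h, h']
    rw [map_div₀, map_neg, Complex.conj_I, map_ofNat, neg_neg, neg_div, neg_smul, ← smul_neg]
    congr 1; ring

theorem smulT_inj (a b : ℂ) (m n : ℤ) (hb : b ≠ 0)
    (h : (a • LaurentPolynomial.T m : LL) = b • LaurentPolynomial.T n) : m = n ∧ a = b := by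
  have h1 := congrArg (fun p : LL => p.coeff n) h
  simp only [LaurentPolynomial.smul_eq_C_mul, ← LaurentPolynomial.single_eq_C_mul_T,
    AddMonoidAlgebra.coeff_single, Finsupp.single_apply, if_true] at h1
  split_ifs at h1 with h2
  · exact ⟨h2, h1⟩
  · exact absurd h1.symm hb

theorem classify (φ : (ℂ ⊗[ℝ] A) ≃ₐ[ℂ] LL) : ∃ i : Fin 3, Nonempty (A ≃ₐ[ℝ] Gam i) := by
  obtain ⟨c, n, hc, hcn⟩ := LL_unit (tau φ (LaurentPolynomial.T 1))
    ((LaurentPolynomial.isUnit_T 1).map (tau φ))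
  rw [← LaurentPolynomial.smul_eq_C_mul] at hcn
  obtain ⟨U, hU⟩ := T_zpow_unit
  have key : tau φ (LaurentPolynomial.T n) = (c ^ n) • LaurentPolynomial.T (n * n) := by
    have e1 : Units.map (tau φ).toMonoidHom U =
        Units.map (algebraMap ℂ LL).toMonoidHom (Units.mk0 c hc) * U ^ n := by
      apply Units.ext
      rw [Units.val_mul, hU]
      have := hU 1
      rw [zpow_one] at this
      simp only [Units.coe_map, this]
      rw [Algebra.smul_def] at hcn
      exact hcn
    have e2 := congrArg (fun t => ((t ^ n : LLˣ) : LL)) e1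
    simp only [mul_zpow, ← map_zpow, ← zpow_mul, Units.val_mul, Units.coe_map, hU] at e2
    rw [Algebra.smul_def]
    refine e2.trans ?_
    congr 1
    simp
  have h2 := tau_tau φ (LaurentPolynomial.T 1)
  rw [hcn, tau_smul, key, smul_smul, ← one_smul ℂ (LaurentPolynomial.T 1 : LL)] at h2
  obtain ⟨hn, hcc⟩ := smulT_inj _ _ _ _ one_ne_zero h2
  rcases mul_self_eq_one_iff.1 hn with rfl | rfl
  · rw [zpow_one] at hcc
    have hnorm : ‖c‖ = 1 := by
      have := congrArg norm hcc
      rw [norm_mul, RCLike.norm_conj, norm_one] at this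
      nlinarith [norm_nonneg c]
    have hce : c = Complex.exp (c.arg * Complex.I) := by
      have := Complex.norm_mul_exp_arg_mul_I c
      rw [hnorm] at this
      simpa using this.symm
    let d : ℂˣ := Units.mk0 (Complex.exp (-(c.arg / 2 : ℝ) * Complex.I)) (Complex.exp_ne_zero _)
    refine ⟨0, caseA (φ.trans (sc d)) ?_⟩
    rw [tau_sc φ d c 1 hcn]
    have : starRingEnd ℂ (d⁻¹ : ℂ) * c * (d : ℂ) ^ (1 : ℤ) = 1 := by
      rw [zpow_one, map_inv₀]
      simp only [d, Units.val_mk0]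
      rw [← Complex.exp_conj, ← Complex.exp_neg]
      nth_rewrite 2 [hce]
      rw [← Complex.exp_add, ← Complex.exp_add, Complex.exp_eq_one_iff]
      refine ⟨0, ?_⟩
      simp only [map_mul, map_neg, Complex.conj_ofReal, Complex.conj_I]
      push_cast
      ring
    rw [this, one_smul]
  · have hreal : starRingEnd ℂ c = c := by
      rw [zpow_neg_one] at hcc
      field_simp at hcc
      exact hcc
    obtain ⟨r, hr⟩ := Complex.conj_eq_iff_real.1 hreal
    subst hr
    have hr0 : r ≠ 0 := by exact_mod_cast hc
    have hs : Real.sqrt |r| ≠ 0 := (Real.sqrt_pos.2 (abs_pos.2 hr0)).ne'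
    have hs2 : Real.sqrt |r| * Real.sqrt |r| = |r| := Real.mul_self_sqrt (abs_nonneg _)
    let d : ℂˣ := Units.mk0 ((Real.sqrt |r| : ℝ) : ℂ) (by exact_mod_cast hs)
    have hd : starRingEnd ℂ (d⁻¹ : ℂ) * r * (d : ℂ) ^ (-1 : ℤ) = ((r / |r| : ℝ) : ℂ) := by
      rw [zpow_neg_one, map_inv₀]
      simp only [d, Units.val_mk0, Complex.conj_ofReal]
      rw [show r / |r| = r / (Real.sqrt |r| * Real.sqrt |r|) by rw [hs2]]
      push_cast
      field_simp
    have := tau_sc φ d r (-1) hcn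
    rw [hd] at this
    rcases lt_or_gt_of_ne hr0 with h | h
    · refine ⟨2, caseC _ (this.trans ?_)⟩
      rw [abs_of_neg h, div_neg, div_self hr0]
      simp
    · refine ⟨1, caseB _ (this.trans ?_)⟩
      rw [abs_of_pos h, div_self hr0]
      simp

end descent

end RealForms


/-- The affine curve `𝔸¹_ℂ ∖ {0}`, with coordinate ring the Laurent polynomials
`ℂ[T, T⁻¹]`, has exactly three isomorphism classes of real forms, given by the three
real conics `xy = 1`, `x² + y² = 1` and `x² + y² = -1`. -/
theorem three_real_forms_of_punctured_line :
    (∀ i j : Fin 3, i ≠ j →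
      IsEmpty ((MvPolynomial (Fin 2) ℝ ⧸ Ideal.span {conic12 i}) ≃ₐ[ℝ]
               (MvPolynomial (Fin 2) ℝ ⧸ Ideal.span {conic12 j}))) ∧
    (∀ i : Fin 3,
      Nonempty ((ℂ ⊗[ℝ] (MvPolynomial (Fin 2) ℝ ⧸ Ideal.span {conic12 i})) ≃ₐ[ℂ]
        LaurentPolynomial ℂ)) ∧
    (∀ (A : Type) [CommRing A] [Algebra ℝ A],
      Nonempty ((ℂ ⊗[ℝ] A) ≃ₐ[ℂ] LaurentPolynomial ℂ) →
      ∃ i : Fin 3,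
        Nonempty (A ≃ₐ[ℝ] (MvPolynomial (Fin 2) ℝ ⧸ Ideal.span {conic12 i}))) := by
  refine ⟨fun i j hij => ⟨fun e => no_iso i j hij e⟩, fun i => ?_, fun A _ _ h => ?_⟩
  · obtain ⟨e, -⟩ := ex_equiv i
    exact ⟨e⟩
  · obtain ⟨φ⟩ := h
    exact classify φ
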